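/- arXiv:math/0512207 — 2 statements merged into one kernel-verified Lean document; each statement's English description precedes it below -/
import Mathlib

section
/- For any compact set A ⊂ R^n and 1 ≤ m ≤ n, ∫_{G(n,m)} Vol_m(A ∩ E) dν(E) ≤ inf_{T ∈ SL(n)} sup_{E ∈ G(n,m)} Vol_m(T(A) ∩ E), where ν is the Haar probability measure on the Grassmannian G(n,m) of m-dimensional subspaces and Vol_m denotes m-dimensional Lebesgue measure on the subspace. -/
open MeasureTheory

/-- Averages over dyadic angles of the reciprocal of a trigonometric polynomial of degree one. -/
lemma sum_inv_trig_le (l : ℕ) : ∀ (A B C τ : ℝ), 0 < A → 0 ≤ τ → τ < 1 →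
    B ^ 2 + C ^ 2 ≤ (τ * A) ^ 2 → 1 ≤ A ^ 2 - (B ^ 2 + C ^ 2) →
    ∑ k ∈ Finset.range (2 ^ l), (A + B * Real.cos (2 * Real.pi * k / 2 ^ l)
      + C * Real.sin (2 * Real.pi * k / 2 ^ l))⁻¹ ≤ 2 ^ l * (1 - τ ^ 2 ^ l)⁻¹ := by
  induction l with
  | zero =>
    intro A B C τ hA h0 h1 hR hD
    simp only [pow_zero, Finset.sum_range_one, Nat.cast_zero, mul_zero, zero_div, Real.cos_zero,
      Real.sin_zero, mul_one, one_mul, pow_one, add_zero]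
    have hB : |B| ≤ τ * A := abs_le_of_sq_le_sq (by nlinarith [sq_nonneg C]) (by positivity)
    have hA1 : 1 ≤ A := by nlinarith [sq_nonneg B, sq_nonneg C]
    refine inv_anti₀ (by linarith) ?_
    nlinarith [neg_le_of_abs_le hB]
  | succ l ih =>
    intro A B C τ hA h0 h1 hR hD
    have hRA : B ^ 2 + C ^ 2 < A ^ 2 := by linarith
    have hτ2 : τ ^ 2 < 1 := by nlinarith
    have h2A : 0 < 2 * A := by linarith
    have key := ih (A - (B ^ 2 + C ^ 2) / (2 * A)) (-(B ^ 2 - C ^ 2) / (2 * A)) (-(B * C) / A) (τ ^ 2)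
      (by rw [sub_pos, div_lt_iff₀ h2A]; nlinarith) (by positivity) hτ2
      (by
        have e : (-(B ^ 2 - C ^ 2) / (2 * A)) ^ 2 + (-(B * C) / A) ^ 2
            = ((B ^ 2 + C ^ 2) / (2 * A)) ^ 2 := by field_simp; ring
        rw [e]
        refine pow_le_pow_left₀ (by positivity) ?_ 2
        have e2 : τ ^ 2 * (A - (B ^ 2 + C ^ 2) / (2 * A))
            = (τ ^ 2 * (2 * A ^ 2 - (B ^ 2 + C ^ 2))) / (2 * A) := by field_simp
        rw [e2]
        gcongr
        nlinarith [sq_nonneg τ])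
      (by
        have e : (A - (B ^ 2 + C ^ 2) / (2 * A)) ^ 2
            - ((-(B ^ 2 - C ^ 2) / (2 * A)) ^ 2 + (-(B * C) / A) ^ 2)
            = A ^ 2 - (B ^ 2 + C ^ 2) := by field_simp; ring
        rw [e]; exact hD)
    rw [← pow_mul, ← pow_succ'] at key
    rw [show Finset.range (2 ^ (l + 1)) = Finset.range (2 ^ l + 2 ^ l) by rw [pow_succ, mul_two],
      Finset.sum_range_add, ← Finset.sum_add_distrib]
    have hsum : ∑ k ∈ Finset.range (2 ^ l),
        ((A + B * Real.cos (2 * Real.pi * k / 2 ^ (l + 1))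
          + C * Real.sin (2 * Real.pi * k / 2 ^ (l + 1)))⁻¹
        + (A + B * Real.cos (2 * Real.pi * (2 ^ l + k : ℕ) / 2 ^ (l + 1))
          + C * Real.sin (2 * Real.pi * (2 ^ l + k : ℕ) / 2 ^ (l + 1)))⁻¹)
        = 2 * ∑ k ∈ Finset.range (2 ^ l), (A - (B ^ 2 + C ^ 2) / (2 * A)
          + -(B ^ 2 - C ^ 2) / (2 * A) * Real.cos (2 * Real.pi * k / 2 ^ l)
          + -(B * C) / A * Real.sin (2 * Real.pi * k / 2 ^ l))⁻¹ := by
      rw [Finset.mul_sum]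
      refine Finset.sum_congr rfl fun k _ => ?_
      have e1 : 2 * Real.pi * (2 ^ l + k : ℕ) / 2 ^ (l + 1)
          = 2 * Real.pi * k / 2 ^ (l + 1) + Real.pi := by
        push_cast; rw [pow_succ]; field_simp; ring
      have e2 : 2 * Real.pi * k / 2 ^ l = 2 * (2 * Real.pi * k / 2 ^ (l + 1)) := by
        rw [pow_succ]; field_simp
      rw [e1, e2, Real.cos_add_pi, Real.sin_add_pi]
      set φ := 2 * Real.pi * k / 2 ^ (l + 1)
      rw [Real.cos_two_mul, Real.sin_two_mul]
      have hcs := Real.sin_sq_add_cos_sq φ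
      set c := Real.cos φ
      set s := Real.sin φ
      have hbd : (B * c + C * s) ^ 2 ≤ B ^ 2 + C ^ 2 := by
        have : (B * c + C * s) ^ 2 + (B * s - C * c) ^ 2 = (B ^ 2 + C ^ 2) * (s ^ 2 + c ^ 2) := by
          ring
        rw [hcs] at this
        nlinarith [sq_nonneg (B * s - C * c)]
      obtain ⟨hl, hu⟩ := abs_lt.mp (abs_lt_of_sq_lt_sq (hbd.trans_lt hRA) hA.le)
      have p1 : A + B * c + C * s ≠ 0 := by linarith
      have p2 : A + B * -c + C * -s ≠ 0 := by linarith
      have p3 : A - (B ^ 2 + C ^ 2) / (2 * A) + -(B ^ 2 - C ^ 2) / (2 * A) * (2 * c ^ 2 - 1)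
          + -(B * C) / A * (2 * s * c) = (A + B * c + C * s) * (A + B * -c + C * -s) / A := by
        have hs2 : s ^ 2 = 1 - c ^ 2 := by linarith
        field_simp
        linear_combination (2 * C ^ 2) * hs2
      have p4 : A + B * c + C * s + (A + B * -c + C * -s) = 2 * A := by ring
      rw [p3, inv_div, inv_add_inv p1 p2, p4, mul_div_assoc]
    rw [hsum]
    calc _ ≤ 2 * (2 ^ l * (1 - τ ^ 2 ^ (l + 1))⁻¹) := by gcongr
      _ = _ := by ring

/-- The rational inequalities behind `sum_inv_sqrt_det_le`, in terms of the eigenvalues `x`, `y`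
of a symmetric `2 × 2` matrix. -/
lemma discrim_bounds {x y g h : ℝ} (hg : 0 < g) (hh : 0 ≤ h) (hx : 0 ≤ x) (hy : 0 ≤ y)
    (hgx : g * x ≤ 1) (hgy : g * y ≤ 1) :
    0 < 1 + h * (x + y) - 2 * g * h * (x * y) ∧
    (g + h) ^ 2 * (x - y) ^ 2 ≤ (1 + h * (x + y) - 2 * g * h * (x * y)) ^ 2 ∧
    1 ≤ (1 + h * (x + y) - 2 * g * h * (x * y)) ^ 2 - (h ^ 2 + 2 * g * h) * (x - y) ^ 2 := by
  have ax : 0 ≤ 1 - g * x := by linarith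
  have ay : 0 ≤ 1 - g * y := by linarith
  have ha : 0 ≤ h * x * (1 - g * y) := by positivity
  have hb : 0 ≤ h * y * (1 - g * x) := by positivity
  have hgx' : 0 ≤ g * x := by positivity
  have hgy' : 0 ≤ g * y := by positivity
  refine ⟨by nlinarith, ?_, ?_⟩
  · rw [← mul_pow]
    refine sq_le_sq' ?_ ?_
    · nlinarith
    · nlinarith
  · have : (1 + h * (x + y) - 2 * g * h * (x * y)) ^ 2 - (h ^ 2 + 2 * g * h) * (x - y) ^ 2
      = (1 + 2 * (h * x * (1 - g * x))) * (1 + 2 * (h * y * (1 - g * y))) := by ring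
    rw [this]
    have h1 : 0 ≤ h * x * (1 - g * x) := by positivity
    have h2 : 0 ≤ h * y * (1 - g * y) := by positivity
    nlinarith [mul_nonneg h1 h2]

/-- The matrix `Rᵀ * diagonal ![a, b] * R - √(a * b) • 1`, where `R` is the rotation by `φ / 2`. -/
noncomputable def planeDeviation (a b φ : ℝ) : Matrix (Fin 2) (Fin 2) ℝ :=
  !![(a + b) / 2 - √(a * b) + (a - b) / 2 * Real.cos φ, -((a - b) / 2 * Real.sin φ);
    -((a - b) / 2 * Real.sin φ), (a + b) / 2 - √(a * b) - (a - b) / 2 * Real.cos φ]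

lemma Matrix.det_add_mul_mul_eq {m k : Type*} [Fintype m] [DecidableEq m] [Fintype k]
    [DecidableEq k] (P : Matrix m m ℝ) (hP : IsUnit P.det) (U : Matrix m k ℝ) (C : Matrix k k ℝ) :
    (P + U * C * U.transpose).det = P.det * (1 + U.transpose * P⁻¹ * U * C).det := by
  have h : P + U * C * U.transpose = P * (1 + P⁻¹ * U * C * U.transpose) := by
    rw [mul_add, mul_one]
    simp only [← Matrix.mul_assoc]
    rw [Matrix.mul_nonsing_inv P hP, Matrix.one_mul]
  rw [h, Matrix.det_mul, Matrix.det_one_add_mul_comm]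
  simp only [Matrix.mul_assoc]

lemma sum_inv_sqrt_le {N : ℕ} (f : ℕ → ℝ) (hf : ∀ k, 0 ≤ f k) {c : ℝ}
    (h : ∑ k ∈ Finset.range N, (f k)⁻¹ ≤ N * c) :
    ∑ k ∈ Finset.range N, (√(f k))⁻¹ ≤ N * √c := by
  have h1 := sq_sum_le_card_mul_sum_sq (s := Finset.range N) (f := fun k => (√(f k))⁻¹)
  simp only [inv_pow, Real.sq_sqrt (hf _), Finset.card_range] at h1
  have h2 : (∑ k ∈ Finset.range N, (√(f k))⁻¹) ^ 2 ≤ N ^ 2 * c := by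
    calc _ ≤ _ := h1
      _ ≤ N * (N * c) := by gcongr
      _ = _ := by ring
  have h3 := Real.le_sqrt_of_sq_le h2
  rwa [Real.sqrt_mul (by positivity), Real.sqrt_sq (by positivity)] at h3

set_option maxHeartbeats 1000000 in
lemma sum_inv_sqrt_det_le {m : ℕ} {P : Matrix (Fin m) (Fin m) ℝ} (hP : P.PosDef)
    (U : Matrix (Fin m) (Fin 2) ℝ) {a b : ℝ} (ha : 0 < a) (hb : 0 < b)
    (hU : ∀ s t : ℝ, -√(a * b) ≤ s → -√(a * b) ≤ t →
      0 ≤ (P + U * Matrix.diagonal ![s, t] * U.transpose).det) (l : ℕ) :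
    ∑ k ∈ Finset.range (2 ^ l),
      (√(P + U * planeDeviation a b (2 * Real.pi * k / 2 ^ l) * U.transpose).det)⁻¹ ≤
      2 ^ l * √((1 - (|a - b| / (a + b)) ^ 2 ^ l)⁻¹) * (√P.det)⁻¹ := by
  have hdet := hP.det_pos
  have hun : IsUnit P.det := hdet.ne'.isUnit
  have hG : (U.transpose * P⁻¹ * U).PosSemidef := by
    simpa using hP.inv.posSemidef.conjTranspose_mul_mul_same U
  simp only [Matrix.det_add_mul_mul_eq P hun] at hU ⊢
  set G := U.transpose * P⁻¹ * U with hGdef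
  set g := √(a * b) with hgdef
  have hg : 0 < g := by positivity
  have hg2 : g ^ 2 = a * b := Real.sq_sqrt (by positivity)
  have hp : 0 ≤ G 0 0 := hG.diag_nonneg
  have hr : 0 ≤ G 1 1 := hG.diag_nonneg
  have hsym : G 1 0 = G 0 1 := by simpa using hG.isHermitian.apply 0 1
  have hδ := hG.det_nonneg
  rw [Matrix.det_fin_two, hsym] at hδ
  have hGe : G = !![G 0 0, G 0 1; G 0 1, G 1 1] := by
    ext i j; fin_cases i <;> fin_cases j <;> simp [hsym]
  have hdiag : ∀ s t : ℝ, (1 + G * Matrix.diagonal ![s, t]).det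
      = 1 + s * G 0 0 + t * G 1 1 + s * t * (G 0 0 * G 1 1 - G 0 1 * G 0 1) := by
    intro s t
    rw [hGe, Matrix.det_fin_two]
    simp [Matrix.vecMul_diagonal]
    ring
  have hpos : ∀ s t : ℝ, -g ≤ s → -g ≤ t →
      0 ≤ 1 + s * G 0 0 + t * G 1 1 + s * t * (G 0 0 * G 1 1 - G 0 1 * G 0 1) := by
    intro s t hs ht
    rw [← hdiag]
    exact nonneg_of_mul_nonneg_right (hU s t hs ht) hdet
  have hdev : ∀ φ : ℝ, (1 + G * planeDeviation a b φ).det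
      = (1 + ((a + b) / 2 - g) * (G 0 0 + G 1 1)
          - 2 * g * ((a + b) / 2 - g) * (G 0 0 * G 1 1 - G 0 1 * G 0 1))
        + (a - b) / 2 * (G 0 0 - G 1 1) * Real.cos φ
        + -((a - b) * G 0 1) * Real.sin φ := by
    intro φ
    rw [hGe, Matrix.det_fin_two, planeDeviation, ← hgdef]
    simp
    have hcs := Real.sin_sq_add_cos_sq φ
    set c := Real.cos φ
    set s := Real.sin φ
    have hab : b * a = g ^ 2 := by linarith
    linear_combination (-(a - b) ^ 2 / 4 * (G 0 0 * G 1 1 - G 0 1 ^ 2)) * hcs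
      + (G 0 0 * G 1 1 - G 0 1 ^ 2) * hab
  set p := G 0 0
  set q := G 0 1
  set r := G 1 1
  set w := √((p - r) ^ 2 + 4 * q ^ 2) with hw
  have hw2 : w ^ 2 = (p - r) ^ 2 + 4 * q ^ 2 := Real.sq_sqrt (by positivity)
  have hw0 : 0 ≤ w := Real.sqrt_nonneg _
  have hh : 0 ≤ (a + b) / 2 - g := by
    have : g ≤ (a + b) / 2 := abs_le_of_sq_le_sq' (by nlinarith [sq_nonneg (a - b)]) (by positivity) |>.2
    linarith
  have hxy : (p + r + w) / 2 * ((p + r - w) / 2) = p * r - q * q := by nlinarith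
  have hwle : w ≤ p + r := abs_le_of_sq_le_sq' (by nlinarith) (by positivity) |>.2
  have hx : 0 ≤ (p + r + w) / 2 := by positivity
  have hy : 0 ≤ (p + r - w) / 2 := by linarith
  have hgx : g * ((p + r + w) / 2) ≤ 1 := by
    have h1 := hpos (-g) (-g) le_rfl le_rfl
    have h2 := hpos (-g) 0 le_rfl (by linarith)
    have h3 := hpos 0 (-g) (by linarith) le_rfl
    have h4 : (g * w) ≤ 2 - g * (p + r) :=
      abs_le_of_sq_le_sq' (by rw [mul_pow, hw2]; nlinarith) (by nlinarith) |>.2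
    linarith
  have hgy : g * ((p + r - w) / 2) ≤ 1 := by nlinarith
  obtain ⟨k1, k2, k3⟩ := discrim_bounds hg hh hx hy hgx hgy
  rw [hxy, show (p + r + w) / 2 + (p + r - w) / 2 = p + r by ring] at k1 k2 k3
  rw [show (p + r + w) / 2 - (p + r - w) / 2 = w by ring, hw2] at k2 k3
  set A := 1 + ((a + b) / 2 - g) * (p + r) - 2 * g * ((a + b) / 2 - g) * (p * r - q * q)
  have hτ1 : |a - b| / (a + b) < 1 := by
    rw [div_lt_one (by positivity), abs_lt]
    constructor <;> linarith
  have hBC : ((a - b) / 2 * (p - r)) ^ 2 + (-((a - b) * q)) ^ 2 ≤ (|a - b| / (a + b) * A) ^ 2 := by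
    have e : (|a - b| / (a + b) * A) ^ 2 = (a - b) ^ 2 * A ^ 2 / (a + b) ^ 2 := by
      rw [mul_pow, div_pow, sq_abs, div_mul_eq_mul_div]
    rw [e, le_div_iff₀ (by positivity)]
    rw [show g + ((a + b) / 2 - g) = (a + b) / 2 by ring] at k2
    calc _ = (a - b) ^ 2 * (((a + b) / 2) ^ 2 * ((p - r) ^ 2 + 4 * q ^ 2)) := by ring
      _ ≤ _ := by gcongr
  have key := sum_inv_trig_le l A ((a - b) / 2 * (p - r)) (-((a - b) * q)) (|a - b| / (a + b)) k1
    (by positivity) hτ1 hBC (by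
      rw [show ((a + b) / 2 - g) ^ 2 + 2 * g * ((a + b) / 2 - g) = (a - b) ^ 2 / 4 by
        linear_combination -hg2] at k3
      linear_combination k3)
  have hnn : ∀ k : ℕ, 0 ≤ (1 + G * planeDeviation a b (2 * Real.pi * k / 2 ^ l)).det := by
    intro k
    rw [hdev]
    set c := Real.cos (2 * Real.pi * k / 2 ^ l)
    set s := Real.sin (2 * Real.pi * k / 2 ^ l)
    have hcs : s ^ 2 + c ^ 2 = 1 := Real.sin_sq_add_cos_sq _
    set B := (a - b) / 2 * (p - r)
    set C := -((a - b) * q)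
    have h1 : B ^ 2 + C ^ 2 ≤ A ^ 2 := hBC.trans (by
      rw [mul_pow]
      exact mul_le_of_le_one_left (sq_nonneg _) (pow_le_one₀ (by positivity) hτ1.le))
    have h2 : (B * c + C * s) ^ 2 ≤ A ^ 2 := by
      have : (B * c + C * s) ^ 2 + (B * s - C * c) ^ 2 = (B ^ 2 + C ^ 2) * (s ^ 2 + c ^ 2) := by
        ring
      rw [hcs] at this
      nlinarith [sq_nonneg (B * s - C * c)]
    have := (abs_le_of_sq_le_sq' h2 k1.le).1
    linarith
  have fin := sum_inv_sqrt_le (N := 2 ^ l)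
    (fun k => (1 + G * planeDeviation a b (2 * Real.pi * k / 2 ^ l)).det) hnn
    (c := (1 - (|a - b| / (a + b)) ^ 2 ^ l)⁻¹) (by simpa [hdev] using key)
  simp only [Real.sqrt_mul hdet.le, mul_inv]
  rw [← Finset.mul_sum, mul_comm]
  push_cast at fin
  gcongr

section PlaneRotation

variable {n : ℕ}

/-- The matrix with columns the standard basis vectors `e i` and `e j`. -/
def planeEmbedding (i j : Fin n) : Matrix (Fin n) (Fin 2) ℝ :=
  Matrix.of fun k c => if k = ![i, j] c then 1 else 0

/-- The rotation of the plane by the angle `θ`. -/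
noncomputable def planeRotation (θ : ℝ) : Matrix (Fin 2) (Fin 2) ℝ :=
  !![Real.cos θ, -Real.sin θ; Real.sin θ, Real.cos θ]

lemma planeRotation_transpose_mul (θ : ℝ) :
    (planeRotation θ).transpose * planeRotation θ = 1 := by
  have h := Real.sin_sq_add_cos_sq θ
  ext i j
  fin_cases i <;> fin_cases j <;> simp [planeRotation, Matrix.mul_apply, Fin.sum_univ_two]
  · linarith
  · ring
  · ring
  · linarith

lemma planeRotation_conj_diagonal (a b θ : ℝ) :
    (planeRotation θ).transpose * Matrix.diagonal ![a - √(a * b), b - √(a * b)] * planeRotation θ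
      = planeDeviation a b (2 * θ) := by
  have h := Real.sin_sq_add_cos_sq θ
  rw [planeDeviation, Real.cos_two_mul, Real.sin_two_mul]
  ext i j
  fin_cases i <;> fin_cases j <;>
    simp [planeRotation, Matrix.mul_apply, Fin.sum_univ_two, Matrix.diagonal_apply]
  · linear_combination (b - √(a * b)) * h
  · ring
  · ring
  · linear_combination (a - √(a * b)) * h

variable {i j : Fin n}

lemma planeEmbedding_transpose_mul (hij : i ≠ j) :
    (planeEmbedding i j).transpose * planeEmbedding i j = 1 := by
  ext k l
  simp only [Matrix.mul_apply, planeEmbedding, Matrix.transpose_apply, Matrix.of_apply, ite_mul,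
    one_mul, zero_mul, Finset.sum_ite_eq', Finset.mem_univ, if_true]
  fin_cases k <;> fin_cases l <;> simp [hij, hij.symm]

lemma planeEmbedding_mul_diagonal_mul (hij : i ≠ j) (s t : ℝ) :
    planeEmbedding i j * Matrix.diagonal ![s, t] * (planeEmbedding i j).transpose
      = Matrix.diagonal fun k => if k = i then s else if k = j then t else 0 := by
  ext k l
  simp only [Matrix.mul_apply, Fin.sum_univ_two, Matrix.diagonal_apply, planeEmbedding,
    Matrix.of_apply, Matrix.transpose_apply]
  by_cases h1 : k = i <;> by_cases h2 : l = i <;> by_cases h3 : k = j <;> by_cases h4 : l = j <;>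
    simp_all [eq_comm]

lemma diagonal_mul_planeEmbedding {d : Fin n → ℝ} {g : ℝ} (hi : d i = g) (hj : d j = g) :
    Matrix.diagonal d * planeEmbedding i j = g • planeEmbedding i j := by
  ext k c
  rw [Matrix.diagonal_mul, Matrix.smul_apply, smul_eq_mul]
  by_cases h : k = ![i, j] c
  · have hd : d k = g := by
      rw [h]
      fin_cases c
      · exact hi
      · exact hj
    rw [hd]
  · simp [planeEmbedding, h]

/-- The rotation of `ℝⁿ` by the angle `θ` in the coordinate plane spanned by `e i` and `e j`. -/
noncomputable def coordRotation (i j : Fin n) (θ : ℝ) : Matrix (Fin n) (Fin n) ℝ :=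
  1 + planeEmbedding i j * (planeRotation θ - 1) * (planeEmbedding i j).transpose

lemma planeEmbedding_transpose_mul_coordRotation (hij : i ≠ j) (θ : ℝ) :
    (planeEmbedding i j).transpose * coordRotation i j θ
      = planeRotation θ * (planeEmbedding i j).transpose := by
  rw [coordRotation, Matrix.mul_add, Matrix.mul_one, ← Matrix.mul_assoc, ← Matrix.mul_assoc,
    planeEmbedding_transpose_mul hij, Matrix.one_mul, Matrix.sub_mul, Matrix.one_mul]
  abel

lemma coordRotation_transpose_mul_planeEmbedding (hij : i ≠ j) (θ : ℝ) :
    (coordRotation i j θ).transpose * planeEmbedding i j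
      = planeEmbedding i j * (planeRotation θ).transpose := by
  rw [← Matrix.transpose_transpose (planeEmbedding i j), ← Matrix.transpose_mul,
    planeEmbedding_transpose_mul_coordRotation hij, Matrix.transpose_mul]

lemma coordRotation_conj_diagonal (hij : i ≠ j) {d : Fin n → ℝ} {g : ℝ} (hi : d i = g)
    (hj : d j = g) (θ : ℝ) :
    (coordRotation i j θ).transpose * Matrix.diagonal d * coordRotation i j θ
      = Matrix.diagonal d := by
  have h1 := diagonal_mul_planeEmbedding hi hj
  set V := planeEmbedding i j
  have hR : Matrix.diagonal d * coordRotation i j θ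
      = Matrix.diagonal d + g • (V * (planeRotation θ - 1) * V.transpose) := by
    rw [coordRotation, Matrix.mul_add, Matrix.mul_one, ← Matrix.mul_assoc, ← Matrix.mul_assoc, h1]
    simp only [Matrix.smul_mul]
    rfl
  have hL : (coordRotation i j θ).transpose * Matrix.diagonal d
      = Matrix.diagonal d + g • (V * ((planeRotation θ).transpose - 1) * V.transpose) := by
    have := congrArg Matrix.transpose hR
    simpa [Matrix.mul_assoc] using this
  have hV : (coordRotation i j θ).transpose * (V * (planeRotation θ - 1) * V.transpose)
      = -(V * ((planeRotation θ).transpose - 1) * V.transpose) := by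
    rw [← Matrix.mul_assoc, ← Matrix.mul_assoc, coordRotation_transpose_mul_planeEmbedding hij,
      Matrix.mul_assoc V, Matrix.mul_sub, planeRotation_transpose_mul, Matrix.mul_one,
      ← Matrix.neg_mul, ← Matrix.mul_neg, neg_sub]
  rw [Matrix.mul_assoc, hR, mul_add, hL, Matrix.mul_smul, hV, smul_neg, add_neg_cancel_right]

lemma coordRotation_transpose_mul (hij : i ≠ j) (θ : ℝ) :
    (coordRotation i j θ).transpose * coordRotation i j θ = 1 := by
  have h := coordRotation_conj_diagonal hij (d := 1) (g := 1) rfl rfl θ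
  simpa using h

/-- Replace the `i`-th and the `j`-th entry of a vector by their geometric mean. -/
noncomputable def equalize (i j : Fin n) (d : Fin n → ℝ) (k : Fin n) : ℝ :=
  if k = i then √(d i * d j) else if k = j then √(d i * d j) else d k

lemma coordRotation_conj_diagonal_eq (hij : i ≠ j) (d : Fin n → ℝ) (θ : ℝ) :
    (coordRotation i j θ).transpose * Matrix.diagonal d * coordRotation i j θ
      = Matrix.diagonal (equalize i j d) + planeEmbedding i j *
        planeDeviation (d i) (d j) (2 * θ) * (planeEmbedding i j).transpose := by
  have hd : Matrix.diagonal d = Matrix.diagonal (equalize i j d) + planeEmbedding i j *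
      Matrix.diagonal ![d i - √(d i * d j), d j - √(d i * d j)] *
        (planeEmbedding i j).transpose := by
    rw [planeEmbedding_mul_diagonal_mul hij, Matrix.diagonal_add]
    congr 1
    funext k
    by_cases h1 : k = i
    · simp [equalize, h1]
    · by_cases h2 : k = j
      · simp [equalize, h2, hij.symm]
      · simp [equalize, h1, h2]
  have hi : equalize i j d i = √(d i * d j) := by simp [equalize]
  have hj : equalize i j d j = √(d i * d j) := by simp [equalize]
  conv_lhs => rw [hd]
  rw [mul_add, add_mul, coordRotation_conj_diagonal hij hi hj, ← planeRotation_conj_diagonal]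
  congr 1
  simp only [← Matrix.mul_assoc]
  rw [coordRotation_transpose_mul_planeEmbedding hij]
  simp only [Matrix.mul_assoc]
  rw [planeEmbedding_transpose_mul_coordRotation hij]

end PlaneRotation

/-- The Grassmannian of `m`-dimensional linear subspaces of `ℝⁿ`. -/
abbrev Grassmannian (n m : ℕ) : Type :=
  {E : Submodule ℝ (EuclideanSpace ℝ (Fin n)) // Module.finrank ℝ E = m}

namespace Grassmannian

variable {n m : ℕ}

/-- The action of a linear automorphism on the Grassmannian. -/
def map (T : EuclideanSpace ℝ (Fin n) ≃ₗ[ℝ] EuclideanSpace ℝ (Fin n)) (E : Grassmannian n m) :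
    Grassmannian n m :=
  ⟨E.1.map (T : EuclideanSpace ℝ (Fin n) →ₗ[ℝ] EuclideanSpace ℝ (Fin n)), by
    rw [LinearEquiv.finrank_map_eq]; exact E.2⟩

/-- A chosen orthonormal basis of a subspace. -/
noncomputable def basis (E : Grassmannian n m) : OrthonormalBasis (Fin m) ℝ E.1 :=
  (stdOrthonormalBasis ℝ E.1).reindex (finCongr E.2)

/-- The matrix whose columns form the chosen orthonormal basis of a subspace. -/
noncomputable def frame (E : Grassmannian n m) : Matrix (Fin n) (Fin m) ℝ :=
  Matrix.of fun i k => (E.basis k : EuclideanSpace ℝ (Fin n)) i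

lemma frame_transpose_mul_frame (E : Grassmannian n m) : E.frame.transpose * E.frame = 1 := by
  ext k l
  have h := E.basis.inner_eq_ite k l
  rw [Submodule.coe_inner, PiLp.inner_apply] at h
  simp only [RCLike.inner_apply, conj_trivial] at h
  rw [Matrix.mul_apply, Matrix.one_apply, ← h]
  simp [frame, mul_comm]

lemma toEuclideanLin_frame (E : Grassmannian n m) (y : EuclideanSpace ℝ (Fin m)) :
    E.frame.toEuclideanLin y = (E.basis.repr.symm y : EuclideanSpace ℝ (Fin n)) := by
  rw [← E.basis.sum_repr_symm]
  ext i
  simp [frame, Matrix.toLpLin_apply, Matrix.mulVec, dotProduct, mul_comm]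

lemma exists_mul_frame_eq (T : EuclideanSpace ℝ (Fin n) ≃ₗ[ℝ] EuclideanSpace ℝ (Fin n))
    (E : Grassmannian n m) : ∃ W : Matrix (Fin m) (Fin m) ℝ,
      Matrix.toEuclideanLin.symm (T : EuclideanSpace ℝ (Fin n) →ₗ[ℝ] EuclideanSpace ℝ (Fin n))
        * E.frame = (E.map T).frame * W := by
  let L : EuclideanSpace ℝ (Fin m) →ₗ[ℝ] EuclideanSpace ℝ (Fin m) :=
    ((E.map T).basis.repr.toLinearEquiv : (E.map T).1 →ₗ[ℝ] EuclideanSpace ℝ (Fin m)) ∘ₗ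
      (T.submoduleMap E.1).toLinearMap ∘ₗ
      (E.basis.repr.symm.toLinearEquiv : EuclideanSpace ℝ (Fin m) →ₗ[ℝ] E.1)
  refine ⟨Matrix.toEuclideanLin.symm L, Matrix.toEuclideanLin.injective ?_⟩
  refine LinearMap.ext fun y => ?_
  rw [Matrix.toLpLin_mul_same, Matrix.toLpLin_mul_same, LinearMap.comp_apply, LinearMap.comp_apply,
    LinearEquiv.apply_symm_apply, LinearEquiv.apply_symm_apply]
  simp only [toEuclideanLin_frame]
  let z : (E.map T).1 := T.submoduleMap E.1 (E.basis.repr.symm y)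
  exact (congrArg Subtype.val ((E.map T).basis.repr.symm_apply_apply z)).symm

/-- The determinant of the compression of a matrix to a subspace. -/
noncomputable def compressionDet (M : Matrix (Fin n) (Fin n) ℝ) (E : Grassmannian n m) : ℝ :=
  (E.frame.transpose * M * E.frame).det

lemma volume_section_eq (E : Grassmannian n m) (A : Set (EuclideanSpace ℝ (Fin n))) :
    volume ((↑) ⁻¹' A : Set E.1) = volume (E.frame.toEuclideanLin ⁻¹' A) := by
  have h := E.basis.measurePreserving_measurableEquiv.symm.measure_preimage_equiv
    ((↑) ⁻¹' A : Set E.1)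
  rw [← h]
  congr 1
  ext y
  simp only [Set.mem_preimage, toEuclideanLin_frame]
  rfl

lemma compressionDet_mul_mul {M N : Matrix (Fin n) (Fin n) ℝ} {E F : Grassmannian n m}
    {W : Matrix (Fin m) (Fin m) ℝ} (h : N * E.frame = F.frame * W) :
    E.compressionDet (N.transpose * M * N) = F.compressionDet M * W.det ^ 2 := by
  have h' : E.frame.transpose * N.transpose = W.transpose * F.frame.transpose := by
    rw [← Matrix.transpose_mul, h, Matrix.transpose_mul]
  have e : E.frame.transpose * (N.transpose * M * N) * E.frame
      = W.transpose * (F.frame.transpose * M * F.frame) * W := by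
    calc _ = (E.frame.transpose * N.transpose) * M * (N * E.frame) := by
          simp only [Matrix.mul_assoc]
      _ = _ := by rw [h, h']; simp only [Matrix.mul_assoc]
  rw [compressionDet, e, Matrix.det_mul, Matrix.det_mul, Matrix.det_transpose, compressionDet]
  ring

lemma compressionDet_one (E : Grassmannian n m) : E.compressionDet 1 = 1 := by
  rw [compressionDet, Matrix.mul_one, frame_transpose_mul_frame, Matrix.det_one]

lemma frame_mulVec_injective (E : Grassmannian n m) : Function.Injective E.frame.mulVec := by
  refine Function.LeftInverse.injective (g := E.frame.transpose.mulVec) fun y => ?_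
  rw [Matrix.mulVec_mulVec, frame_transpose_mul_frame, Matrix.one_mulVec]

lemma posDef_compression {M : Matrix (Fin n) (Fin n) ℝ} (hM : M.PosDef) (E : Grassmannian n m) :
    (E.frame.transpose * M * E.frame).PosDef := by
  simpa using hM.conjTranspose_mul_mul_same E.frame_mulVec_injective

lemma compressionDet_pos {M : Matrix (Fin n) (Fin n) ℝ} (hM : M.PosDef) (E : Grassmannian n m) :
    0 < E.compressionDet M :=
  (posDef_compression hM E).det_pos

lemma compressionDet_mul_mul_of_orthogonal {R M : Matrix (Fin n) (Fin n) ℝ}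
    (hR : R.transpose * R = 1) {T : EuclideanSpace ℝ (Fin n) ≃ₗ[ℝ] EuclideanSpace ℝ (Fin n)}
    (hT : Matrix.toEuclideanLin.symm
      (T : EuclideanSpace ℝ (Fin n) →ₗ[ℝ] EuclideanSpace ℝ (Fin n)) = R) (E : Grassmannian n m) :
    (E.map T).compressionDet M = E.compressionDet (R.transpose * M * R) := by
  obtain ⟨W, hW⟩ := exists_mul_frame_eq T E
  rw [hT] at hW
  have h1 := compressionDet_mul_mul (M := 1) hW
  rw [Matrix.mul_one, hR, compressionDet_one, compressionDet_one, one_mul] at h1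
  rw [compressionDet_mul_mul hW, ← h1, mul_one]

lemma volume_section_eq_mul (T : EuclideanSpace ℝ (Fin n) ≃ₗ[ℝ] EuclideanSpace ℝ (Fin n))
    {N : Matrix (Fin n) (Fin n) ℝ} (hN : (N.transpose * N).PosDef)
    (hT : Matrix.toEuclideanLin.symm
      (T : EuclideanSpace ℝ (Fin n) →ₗ[ℝ] EuclideanSpace ℝ (Fin n)) = N)
    (E : Grassmannian n m) (A : Set (EuclideanSpace ℝ (Fin n))) :
    volume ((↑) ⁻¹' A : Set E.1) =
      ENNReal.ofReal (√(E.compressionDet (N.transpose * N)))⁻¹ *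
        volume ((↑) ⁻¹' (T '' A) : Set (E.map T).1) := by
  obtain ⟨W, hW⟩ := exists_mul_frame_eq T E
  have hTN : Matrix.toEuclideanLin N = T := by rw [← hT, LinearEquiv.apply_symm_apply]
  rw [hT] at hW
  have h1 := compressionDet_mul_mul (M := 1) hW
  rw [Matrix.mul_one, compressionDet_one, one_mul] at h1
  have hW0 : W.det ≠ 0 := by
    have := compressionDet_pos hN E
    rw [h1] at this
    exact fun h => by simp [h] at this
  have hdet : LinearMap.det W.toEuclideanLin = W.det := by
    rw [Matrix.toEuclideanLin_eq_toLin_orthonormal, LinearMap.det_toLin]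
  have hpre : E.frame.toEuclideanLin ⁻¹' A =
      W.toEuclideanLin ⁻¹' ((E.map T).frame.toEuclideanLin ⁻¹' (T '' A)) := by
    ext y
    have hy : (E.map T).frame.toEuclideanLin (W.toEuclideanLin y)
        = T (E.frame.toEuclideanLin y) := by
      have := congrArg (fun Q => Matrix.toEuclideanLin Q y) hW
      simp only [Matrix.toLpLin_mul_same, LinearMap.comp_apply] at this
      rw [← this, hTN]
      rfl
    rw [Set.mem_preimage, Set.mem_preimage, Set.mem_preimage, hy, T.injective.mem_set_image]
  rw [volume_section_eq, volume_section_eq, hpre,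
    Measure.addHaar_preimage_linearMap _ (by rwa [hdet]), hdet, h1, Real.sqrt_sq_eq_abs, abs_inv]

/-- The linear isometry of `ℝⁿ` given by an orthogonal matrix. -/
noncomputable def isometryOfOrthogonal {R : Matrix (Fin n) (Fin n) ℝ} (hR : R.transpose * R = 1) :
    EuclideanSpace ℝ (Fin n) ≃ₗᵢ[ℝ] EuclideanSpace ℝ (Fin n) where
  toLinearEquiv := LinearEquiv.ofLinearMap R.toEuclideanLin R.transpose.toEuclideanLin
    (by rw [← Matrix.toLpLin_mul_same, mul_eq_one_comm.mp hR, Matrix.toLpLin_one])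
    (by rw [← Matrix.toLpLin_mul_same, hR, Matrix.toLpLin_one])
  norm_map' x := by
    rw [← sq_eq_sq₀ (norm_nonneg _) (norm_nonneg _), EuclideanSpace.real_norm_sq_eq,
      EuclideanSpace.real_norm_sq_eq]
    have h : R.mulVec x.ofLp ⬝ᵥ R.mulVec x.ofLp = x.ofLp ⬝ᵥ x.ofLp := by
      rw [Matrix.dotProduct_mulVec, Matrix.vecMul_mulVec, hR, Matrix.vecMul_one]
    simpa [dotProduct, sq, Matrix.toLpLin_apply] using h

/-- Invariance of a measure on the Grassmannian under the orthogonal group. -/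
def IsRotationInvariant [MeasurableSpace (Submodule ℝ (EuclideanSpace ℝ (Fin n)))]
    (ν : Measure (Grassmannian n m)) : Prop :=
  ∀ O : EuclideanSpace ℝ (Fin n) ≃ₗᵢ[ℝ] EuclideanSpace ℝ (Fin n),
    Measure.map (map O.toLinearEquiv) ν = ν

/-- The reciprocal of the factor by which a linear map with Gram matrix `M` scales volumes on a
subspace. -/
noncomputable def invJacobian (M : Matrix (Fin n) (Fin n) ℝ) (E : Grassmannian n m) : ENNReal :=
  ENNReal.ofReal (√(E.compressionDet M))⁻¹

section Invariance

variable [MeasurableSpace (Submodule ℝ (EuclideanSpace ℝ (Fin n)))]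
  {ν : Measure (Grassmannian n m)}

lemma IsRotationInvariant.lintegral_invJacobian_le (hν : IsRotationInvariant ν)
    {R : Matrix (Fin n) (Fin n) ℝ} (hR : R.transpose * R = 1) (M : Matrix (Fin n) (Fin n) ℝ) :
    ∫⁻ E, invJacobian M E ∂ν ≤ ∫⁻ E, invJacobian (R.transpose * M * R) E ∂ν := by
  have h := hν (isometryOfOrthogonal hR)
  calc ∫⁻ E, invJacobian M E ∂ν
      = ∫⁻ E, invJacobian M E ∂(ν.map (map (isometryOfOrthogonal hR).toLinearEquiv)) := by rw [h]
    _ ≤ ∫⁻ E, invJacobian M (map (isometryOfOrthogonal hR).toLinearEquiv E) ∂ν :=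
      lintegral_map_le _ _
    _ = _ := by
      refine lintegral_congr fun E => ?_
      rw [invJacobian, invJacobian, compressionDet_mul_mul_of_orthogonal hR]
      exact Matrix.toEuclideanLin.symm_apply_apply R

lemma _root_.MeasureTheory.sum_lintegral_le_lintegral_sum {α ι : Type*} [MeasurableSpace α]
    (μ : Measure α) (s : Finset ι) (f : ι → α → ENNReal) :
    ∑ i ∈ s, ∫⁻ x, f i x ∂μ ≤ ∫⁻ x, ∑ i ∈ s, f i x ∂μ := by
  classical
  induction s using Finset.induction_on with
  | empty => simp
  | insert i s hi ih =>
    simp only [Finset.sum_insert hi]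
    exact (add_le_add_right ih _).trans (le_lintegral_add _ _)

end Invariance

lemma _root_.equalize_pos {d : Fin n → ℝ} (hd : ∀ k, 0 < d k) (i j k : Fin n) :
    0 < equalize i j d k := by
  have h := Real.sqrt_pos.mpr (mul_pos (hd i) (hd j))
  unfold equalize
  split_ifs
  exacts [h, h, hd k]

lemma sum_invJacobian_diagonal_le {i j : Fin n} (hij : i ≠ j) {d : Fin n → ℝ}
    (hd : ∀ k, 0 < d k) (l : ℕ) (E : Grassmannian n m) :
    ∑ k ∈ Finset.range (2 ^ l), invJacobian ((coordRotation i j (Real.pi * k / 2 ^ l)).transpose *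
        Matrix.diagonal d * coordRotation i j (Real.pi * k / 2 ^ l)) E ≤
      ENNReal.ofReal (2 ^ l * √((1 - (|d i - d j| / (d i + d j)) ^ 2 ^ l)⁻¹)) *
        invJacobian (Matrix.diagonal (equalize i j d)) E := by
  have hP : (Matrix.diagonal (equalize i j d)).PosDef :=
    Matrix.PosDef.diagonal (equalize_pos hd i j)
  have key := sum_inv_sqrt_det_le (posDef_compression hP E)
    (E.frame.transpose * planeEmbedding i j) (hd i) (hd j) (fun s t hs ht => ?_) l
  · unfold invJacobian
    rw [← ENNReal.ofReal_mul (by positivity),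
      ← ENNReal.ofReal_sum_of_nonneg fun _ _ => by positivity]
    refine ENNReal.ofReal_le_ofReal (le_of_eq_of_le ?_ key)
    refine Finset.sum_congr rfl fun k _ => ?_
    rw [compressionDet, coordRotation_conj_diagonal_eq hij]
    have hθ : 2 * (Real.pi * k / 2 ^ l) = 2 * Real.pi * k / 2 ^ l := by ring
    rw [hθ, Matrix.mul_add, Matrix.add_mul, Matrix.transpose_mul, Matrix.transpose_transpose]
    simp only [Matrix.mul_assoc]
  · have e : E.frame.transpose * Matrix.diagonal (equalize i j d) * E.frame +
        E.frame.transpose * planeEmbedding i j * Matrix.diagonal ![s, t] *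
          (E.frame.transpose * planeEmbedding i j).transpose =
        E.frame.transpose * Matrix.diagonal (fun k => equalize i j d k +
          if k = i then s else if k = j then t else 0) * E.frame := by
      rw [← Matrix.diagonal_add, ← planeEmbedding_mul_diagonal_mul hij, Matrix.mul_add,
        Matrix.add_mul,
        Matrix.transpose_mul, Matrix.transpose_transpose]
      simp only [Matrix.mul_assoc]
    rw [e]
    have hs : (Matrix.diagonal (fun k => equalize i j d k +
          if k = i then s else if k = j then t else 0)).PosSemidef := by
      refine Matrix.PosSemidef.diagonal fun k => ?_
      have hk := hd k
      simp only [Pi.zero_apply, equalize]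
      split_ifs <;> linarith
    have h := (hs.conjTranspose_mul_mul_same E.frame).det_nonneg
    rwa [Matrix.conjTranspose_eq_transpose_of_trivial] at h

section Invariance

variable [MeasurableSpace (Submodule ℝ (EuclideanSpace ℝ (Fin n)))]
  {ν : Measure (Grassmannian n m)}

lemma IsRotationInvariant.lintegral_invJacobian_diagonal_le (hν : IsRotationInvariant ν)
    {d : Fin n → ℝ} (hd : ∀ k, 0 < d k) {i j : Fin n} (hij : i ≠ j) :
    ∫⁻ E, invJacobian (Matrix.diagonal d) E ∂ν ≤
      ∫⁻ E, invJacobian (Matrix.diagonal (equalize i j d)) E ∂ν := by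
  set τ := |d i - d j| / (d i + d j)
  set J := ∫⁻ E, invJacobian (Matrix.diagonal (equalize i j d)) E ∂ν
  have hi := hd i
  have hj := hd j
  have hτ0 : 0 ≤ τ := by positivity
  have hτ1 : τ < 1 := by
    rw [div_lt_one (by positivity), abs_lt]
    constructor <;> linarith
  have step (l : ℕ) : ∫⁻ E, invJacobian (Matrix.diagonal d) E ∂ν ≤
      ENNReal.ofReal √((1 - τ ^ 2 ^ l)⁻¹) * J := by
    have h2 : (2 : ENNReal) ^ l ≠ 0 := by simp
    have h2' : (2 : ENNReal) ^ l ≠ ⊤ := by simp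
    rw [← ENNReal.mul_le_mul_iff_right h2 h2']
    calc (2 : ENNReal) ^ l * ∫⁻ E, invJacobian (Matrix.diagonal d) E ∂ν
        = ∑ k ∈ Finset.range (2 ^ l), ∫⁻ E, invJacobian (Matrix.diagonal d) E ∂ν := by simp
      _ ≤ ∑ k ∈ Finset.range (2 ^ l), ∫⁻ E, invJacobian
          ((coordRotation i j (Real.pi * k / 2 ^ l)).transpose * Matrix.diagonal d *
            coordRotation i j (Real.pi * k / 2 ^ l)) E ∂ν :=
        Finset.sum_le_sum fun k _ =>
          hν.lintegral_invJacobian_le (coordRotation_transpose_mul hij _) _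
      _ ≤ _ := sum_lintegral_le_lintegral_sum _ _ _
      _ ≤ _ := lintegral_mono (sum_invJacobian_diagonal_le hij hd l)
      _ = _ := lintegral_const_mul' _ _ ENNReal.ofReal_ne_top
      _ = _ := by
        rw [ENNReal.ofReal_mul (by positivity), ENNReal.ofReal_pow zero_le_two, mul_assoc]
        simp [τ, J]
  have hlim : Filter.Tendsto (fun l : ℕ => ENNReal.ofReal √((1 - τ ^ 2 ^ l)⁻¹)) Filter.atTop
      (nhds 1) := by
    have h1 : Filter.Tendsto (fun l : ℕ => τ ^ 2 ^ l) Filter.atTop (nhds 0) :=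
      (tendsto_pow_atTop_nhds_zero_of_lt_one hτ0 hτ1).comp
        (tendsto_pow_atTop_atTop_of_one_lt one_lt_two)
    have h2 := ((h1.const_sub 1).inv₀ (by norm_num)).sqrt
    simpa using ENNReal.tendsto_ofReal h2
  have hlim' := ENNReal.Tendsto.mul_const (b := J) hlim (Or.inl one_ne_zero)
  rw [one_mul] at hlim'
  exact ge_of_tendsto' hlim' step

end Invariance

lemma _root_.sum_equalize {i j : Fin n} (hij : i ≠ j) (d : Fin n → ℝ) (f : ℝ → ℝ) :
    ∑ k, f (equalize i j d k) = ∑ k, f (d k) + 2 * f √(d i * d j) - f (d i) - f (d j) := by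
  have h := Fintype.sum_eq_add (f := fun k => f (equalize i j d k) - f (d k)) i j hij
    fun k hk => by simp [equalize, hk.1, hk.2]
  have hi : equalize i j d i = √(d i * d j) := by simp [equalize]
  have hj : equalize i j d j = √(d i * d j) := by simp [equalize]
  rw [Finset.sum_sub_distrib, hi, hj] at h
  linarith

lemma pow_le_compressionDet_diagonal {d : Fin n → ℝ} {c : ℝ} (hc : 0 ≤ c) (hd : ∀ k, c ≤ d k)
    (E : Grassmannian n m) : c ^ m ≤ E.compressionDet (Matrix.diagonal d) := by
  have hS : (E.frame.transpose * Matrix.diagonal (fun k => d k - c) * E.frame).PosSemidef := by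
    have h : (Matrix.diagonal (fun k => d k - c)).PosSemidef :=
      Matrix.PosSemidef.diagonal fun k => sub_nonneg.mpr (hd k)
    simpa using h.conjTranspose_mul_mul_same E.frame
  have e : E.frame.transpose * Matrix.diagonal d * E.frame =
      E.frame.transpose * Matrix.diagonal (fun k => d k - c) * E.frame + c • 1 := by
    have h : Matrix.diagonal d = Matrix.diagonal (fun k => d k - c) + c • 1 := by
      rw [Matrix.smul_one_eq_diagonal, Matrix.diagonal_add]
      simp
    rw [h, Matrix.mul_add, Matrix.add_mul, Matrix.mul_smul, Matrix.mul_one, Matrix.smul_mul,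
      frame_transpose_mul_frame]
  have hP : (E.frame.transpose * Matrix.diagonal d * E.frame).IsHermitian := by
    rw [e]
    exact hS.isHermitian.add (by simp [Matrix.IsHermitian])
  rw [compressionDet, hP.det_eq_prod_eigenvalues]
  calc c ^ m = ∏ _k : Fin m, c := by simp
    _ ≤ _ := Finset.prod_le_prod (fun _ _ => hc) fun k _ => ?_
  set v := (hP.eigenvectorBasis k).ofLp with hv_def
  have hv : v ⬝ᵥ v = 1 := by
    have := EuclideanSpace.real_norm_sq_eq (hP.eigenvectorBasis k)
    rw [hP.eigenvectorBasis.norm_eq_one] at this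
    simp [v, dotProduct, ← sq, ← this]
  have h0 := hS.dotProduct_mulVec_nonneg v
  have h1 := congrArg (fun Q => v ⬝ᵥ Q.mulVec v) e
  rw [RCLike.ofReal_real_eq_id, id_eq, hP.eigenvalues_eq, ← hv_def]
  simp only [star_trivial, RCLike.re_to_real, Matrix.add_mulVec, Matrix.smul_mulVec,
    Matrix.one_mulVec, dotProduct_add, dotProduct_smul, hv, smul_eq_mul, mul_one] at h0 h1 ⊢
  linarith

section Invariance

variable [MeasurableSpace (Submodule ℝ (EuclideanSpace ℝ (Fin n)))]
  {ν : Measure (Grassmannian n m)}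

lemma IsRotationInvariant.exists_lintegral_invJacobian_diagonal_le (hν : IsRotationInvariant ν)
    {d : Fin n → ℝ} (hd : ∀ k, 0 < d k) (hd0 : ∑ k, Real.log (d k) = 0) :
    ∃ d' : Fin n → ℝ, (∀ k, 0 < d' k) ∧ ∑ k, Real.log (d' k) = 0 ∧
      ∑ k, Real.log (d' k) ^ 2 ≤ (1 - 1 / (2 * n : ℝ)) * ∑ k, Real.log (d k) ^ 2 ∧
      ∫⁻ E, invJacobian (Matrix.diagonal d) E ∂ν ≤
        ∫⁻ E, invJacobian (Matrix.diagonal d') E ∂ν := by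
  by_cases hΦ : ∑ k, Real.log (d k) ^ 2 = 0
  · exact ⟨d, hd, hd0, by simp [hΦ], le_rfl⟩
  have hn : Nonempty (Fin n) := by
    by_contra h
    rw [not_nonempty_iff] at h
    exact hΦ (Finset.sum_of_isEmpty _)
  obtain ⟨i, -, hi⟩ := Finset.univ.exists_max_image (fun k => Real.log (d k)) Finset.univ_nonempty
  obtain ⟨j, -, hj⟩ := Finset.univ.exists_min_image (fun k => Real.log (d k)) Finset.univ_nonempty
  have hi0 : 0 ≤ Real.log (d i) := by
    by_contra! h
    have := Finset.sum_neg (fun k _ => (hi k (Finset.mem_univ k)).trans_lt h)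
      Finset.univ_nonempty
    exact this.ne hd0
  have hj0 : Real.log (d j) ≤ 0 := by
    by_contra! h
    have := Finset.sum_pos (fun k _ => h.trans_le (hj k (Finset.mem_univ k)))
      Finset.univ_nonempty
    exact this.ne' hd0
  have hle (k : Fin n) : Real.log (d k) ^ 2 ≤ (Real.log (d i) - Real.log (d j)) ^ 2 := by
    have h1 := hi k (Finset.mem_univ k)
    have h2 := hj k (Finset.mem_univ k)
    apply sq_le_sq'
    · linarith
    · linarith
  have hsum : ∑ k, Real.log (d k) ^ 2 ≤ n * (Real.log (d i) - Real.log (d j)) ^ 2 := by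
    simpa using Finset.sum_le_card_nsmul Finset.univ _ _ fun k _ => hle k
  have hij : i ≠ j := by
    rintro rfl
    refine hΦ (le_antisymm (by simpa using hsum) (Finset.sum_nonneg fun k _ => sq_nonneg _))
  have hlog : Real.log √(d i * d j) = (Real.log (d i) + Real.log (d j)) / 2 := by
    rw [Real.log_sqrt (mul_pos (hd i) (hd j)).le, Real.log_mul (hd i).ne' (hd j).ne']
  have hn0 : (0 : ℝ) < n := by
    exact_mod_cast Fin.pos_iff_nonempty.mpr hn
  refine ⟨equalize i j d, equalize_pos hd i j, ?_, ?_,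
    hν.lintegral_invJacobian_diagonal_le hd hij⟩
  · rw [sum_equalize hij d Real.log, hd0, hlog]
    ring
  · rw [sum_equalize hij d fun x => Real.log x ^ 2, hlog]
    have h : 1 / (2 * n : ℝ) * ∑ k, Real.log (d k) ^ 2 ≤
        (Real.log (d i) - Real.log (d j)) ^ 2 / 2 := by
      rw [one_div_mul_eq_div, div_le_div_iff₀ (by positivity) (by positivity)]
      nlinarith
    linarith

lemma IsRotationInvariant.lintegral_invJacobian_diagonal_le_one (hν : IsRotationInvariant ν)
    [IsProbabilityMeasure ν] {d : Fin n → ℝ} (hd : ∀ k, 0 < d k)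
    (hd0 : ∑ k, Real.log (d k) = 0) : ∫⁻ E, invJacobian (Matrix.diagonal d) E ∂ν ≤ 1 := by
  set Φ := ∑ k, Real.log (d k) ^ 2
  set r := 1 - 1 / (2 * n : ℝ)
  have hr1 : r < 1 ∨ Φ = 0 := by
    rcases Nat.eq_zero_or_pos n with rfl | hn
    · right
      simp [Φ]
    · left
      have : (0 : ℝ) < n := by exact_mod_cast hn
      exact sub_lt_self _ (by positivity)
  have hr0 : 0 ≤ r := by
    rcases Nat.eq_zero_or_pos n with rfl | hn
    · simp [r]
    · have : (1 : ℝ) ≤ n := by exact_mod_cast hn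
      rw [sub_nonneg, div_le_one (by positivity)]
      linarith
  have iter (l : ℕ) : ∃ d' : Fin n → ℝ, (∀ k, 0 < d' k) ∧ ∑ k, Real.log (d' k) = 0 ∧
      ∑ k, Real.log (d' k) ^ 2 ≤ r ^ l * Φ ∧
      ∫⁻ E, invJacobian (Matrix.diagonal d) E ∂ν ≤
        ∫⁻ E, invJacobian (Matrix.diagonal d') E ∂ν := by
    induction l with
    | zero => exact ⟨d, hd, hd0, by simp [Φ], le_rfl⟩
    | succ l ih =>
      obtain ⟨d₁, h1, h2, h3, h4⟩ := ih
      obtain ⟨d₂, g1, g2, g3, g4⟩ := hν.exists_lintegral_invJacobian_diagonal_le h1 h2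
      refine ⟨d₂, g1, g2, g3.trans ?_, h4.trans g4⟩
      rw [pow_succ', mul_assoc]
      exact mul_le_mul_of_nonneg_left h3 hr0
  have bound (l : ℕ) : ∫⁻ E, invJacobian (Matrix.diagonal d) E ∂ν ≤
      ENNReal.ofReal (√(Real.exp (-√(r ^ l * Φ)) ^ m))⁻¹ := by
    obtain ⟨d', h1, -, h3, h4⟩ := iter l
    refine h4.trans ?_
    have hc (k : Fin n) : Real.exp (-√(r ^ l * Φ)) ≤ d' k := by
      rw [← Real.le_log_iff_exp_le (h1 k)]
      refine (abs_le.mp (Real.abs_le_sqrt (le_trans ?_ h3))).1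
      exact Finset.single_le_sum (f := fun k => Real.log (d' k) ^ 2) (fun k _ => sq_nonneg _)
        (Finset.mem_univ k)
    calc ∫⁻ E, invJacobian (Matrix.diagonal d') E ∂ν
        ≤ ∫⁻ _, ENNReal.ofReal (√(Real.exp (-√(r ^ l * Φ)) ^ m))⁻¹ ∂ν := by
          refine lintegral_mono fun E => ENNReal.ofReal_le_ofReal ?_
          refine inv_anti₀ (by positivity) (Real.sqrt_le_sqrt ?_)
          exact pow_le_compressionDet_diagonal (Real.exp_pos _).le hc E
      _ = _ := by simp
  have hlim : Filter.Tendsto (fun l : ℕ => r ^ l * Φ) Filter.atTop (nhds 0) := by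
    rcases hr1 with h | h
    · simpa using (tendsto_pow_atTop_nhds_zero_of_lt_one hr0 h).mul_const Φ
    · simp [h]
  have hcont : Continuous fun x : ℝ => (√(Real.exp (-√x) ^ m))⁻¹ :=
    Continuous.inv₀ (by fun_prop) fun x => by positivity
  have hlim' := ENNReal.tendsto_ofReal ((hcont.tendsto 0).comp hlim)
  simp only [Real.sqrt_zero, neg_zero, Real.exp_zero, one_pow, Real.sqrt_one, inv_one,
    ENNReal.ofReal_one] at hlim'
  exact ge_of_tendsto' hlim' bound

lemma IsRotationInvariant.lintegral_invJacobian_le_one (hν : IsRotationInvariant ν)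
    [IsProbabilityMeasure ν] {M : Matrix (Fin n) (Fin n) ℝ} (hM : M.PosDef) (hdet : M.det = 1) :
    ∫⁻ E, invJacobian M E ∂ν ≤ 1 := by
  have hpos := hM.eigenvalues_pos
  have hR : (hM.isHermitian.eigenvectorUnitary : Matrix (Fin n) (Fin n) ℝ).transpose *
      (hM.isHermitian.eigenvectorUnitary : Matrix (Fin n) (Fin n) ℝ) = 1 := by
    have := Matrix.UnitaryGroup.star_mul_self hM.isHermitian.eigenvectorUnitary
    rwa [Matrix.star_eq_conjTranspose, Matrix.conjTranspose_eq_transpose_of_trivial] at this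
  refine (hν.lintegral_invJacobian_le hR M).trans ?_
  have hD : (hM.isHermitian.eigenvectorUnitary : Matrix (Fin n) (Fin n) ℝ).transpose * M *
      (hM.isHermitian.eigenvectorUnitary : Matrix (Fin n) (Fin n) ℝ) =
      Matrix.diagonal hM.isHermitian.eigenvalues := by
    have := hM.isHermitian.conjStarAlgAut_star_eigenvectorUnitary
    rw [Unitary.conjStarAlgAut_star_apply] at this
    simpa [Matrix.star_eq_conjTranspose] using this
  rw [hD]
  refine hν.lintegral_invJacobian_diagonal_le_one hpos ?_
  rw [← Real.log_prod fun k _ => (hpos k).ne']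
  have := hM.isHermitian.det_eq_prod_eigenvalues
  rw [hdet] at this
  simp only [RCLike.ofReal_real_eq_id, id_eq] at this
  rw [← this, Real.log_one]

lemma IsRotationInvariant.lintegral_volume_section_le (hν : IsRotationInvariant ν)
    [IsProbabilityMeasure ν] (T : EuclideanSpace ℝ (Fin n) ≃ₗ[ℝ] EuclideanSpace ℝ (Fin n))
    (hT : LinearMap.det (T : EuclideanSpace ℝ (Fin n) →ₗ[ℝ] EuclideanSpace ℝ (Fin n)) = 1)
    (A : Set (EuclideanSpace ℝ (Fin n))) :
    ∫⁻ E : Grassmannian n m, volume ((↑) ⁻¹' A : Set E.1) ∂ν ≤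
      ⨆ E : Grassmannian n m, volume ((↑) ⁻¹' (T '' A) : Set E.1) := by
  set S := ⨆ E : Grassmannian n m, volume ((↑) ⁻¹' (T '' A) : Set E.1)
  rcases eq_or_ne S ⊤ with hS | hS
  · simp [hS]
  set N := Matrix.toEuclideanLin.symm
    (T : EuclideanSpace ℝ (Fin n) →ₗ[ℝ] EuclideanSpace ℝ (Fin n)) with hN
  have hNdet : N.det = 1 := by
    have h : Matrix.toEuclideanLin N = T := LinearEquiv.apply_symm_apply _ _
    rw [← hT, ← h, Matrix.toEuclideanLin_eq_toLin_orthonormal, LinearMap.det_toLin]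
  have hM : (N.transpose * N).PosDef := by
    rw [← Matrix.conjTranspose_eq_transpose_of_trivial]
    refine Matrix.PosDef.conjTranspose_mul_self N (Matrix.mulVec_injective_of_isUnit ?_)
    rw [Matrix.isUnit_iff_isUnit_det, hNdet]
    exact isUnit_one
  calc ∫⁻ E : Grassmannian n m, volume ((↑) ⁻¹' A : Set E.1) ∂ν
      ≤ ∫⁻ E : Grassmannian n m, invJacobian (N.transpose * N) E * S ∂ν := by
        refine lintegral_mono fun E => ?_
        rw [volume_section_eq_mul T hM hN.symm E A]
        exact mul_le_mul_right (le_iSup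
          (fun E : Grassmannian n m => volume ((↑) ⁻¹' (T '' A) : Set E.1)) (E.map T)) _
    _ = (∫⁻ E, invJacobian (N.transpose * N) E ∂ν) * S := lintegral_mul_const' _ _ hS
    _ ≤ 1 * S := by
        refine mul_le_mul_left (hν.lintegral_invJacobian_le_one hM ?_) _
        rw [Matrix.det_mul, Matrix.det_transpose, hNdet, one_mul]
    _ = S := one_mul S

end Invariance

end Grassmannian

/-- For any compact set `A ⊂ ℝⁿ` and `1 ≤ m ≤ n`, the average `m`-dimensional volume of
central sections over the Grassmannian (with its rotation-invariant probability measure)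
is at most `inf_{T ∈ SL(n)} sup_{E} Vol_m(T(A) ∩ E)`. -/
theorem average_section_le_inf_sup {n m : ℕ} (hm : 1 ≤ m) (hmn : m ≤ n)
    [MeasurableSpace (Submodule ℝ (EuclideanSpace ℝ (Fin n)))]
    (A : Set (EuclideanSpace ℝ (Fin n))) (hA : IsCompact A)
    (ν : Measure {E : Submodule ℝ (EuclideanSpace ℝ (Fin n)) // Module.finrank ℝ E = m})
    [IsProbabilityMeasure ν]
    (hinv : ∀ O : EuclideanSpace ℝ (Fin n) ≃ₗᵢ[ℝ] EuclideanSpace ℝ (Fin n),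
      Measure.map
        (fun E : {E : Submodule ℝ (EuclideanSpace ℝ (Fin n)) // Module.finrank ℝ E = m} =>
          (⟨E.1.map (O.toLinearEquiv : EuclideanSpace ℝ (Fin n) →ₗ[ℝ] EuclideanSpace ℝ (Fin n)),
            by rw [LinearEquiv.finrank_map_eq]; exact E.2⟩ :
            {E : Submodule ℝ (EuclideanSpace ℝ (Fin n)) // Module.finrank ℝ E = m})) ν = ν) :
    ∫⁻ E : {E : Submodule ℝ (EuclideanSpace ℝ (Fin n)) // Module.finrank ℝ E = m},
        volume ((↑) ⁻¹' A : Set E.1) ∂ν ≤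
      ⨅ (T : EuclideanSpace ℝ (Fin n) ≃ₗ[ℝ] EuclideanSpace ℝ (Fin n))
        (_ : LinearMap.det (T : EuclideanSpace ℝ (Fin n) →ₗ[ℝ] EuclideanSpace ℝ (Fin n)) = 1),
        ⨆ E : {E : Submodule ℝ (EuclideanSpace ℝ (Fin n)) // Module.finrank ℝ E = m},
          volume ((↑) ⁻¹' ((⇑T) '' A) : Set E.1) :=
  le_iInf₂ fun T hT => Grassmannian.IsRotationInvariant.lintegral_volume_section_le hinv T hT A
end

section
/- Let X = (R^n, ‖·‖_K) have type-2 constant T_2(X_K) and let μ be a finite, compactly supported isotropic Borel measure on R^n. Then √n · M_2(K) ≤ T_2(X_K) · (∫ ‖x‖_K² dμ(x))^{1/2}, where M_2(K) = (∫_{S^{n-1}} ‖θ‖_K² dσ(θ))^{1/2} with σ the Haar probability measure on S^{n-1}. -/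
open MeasureTheory ProbabilityTheory
open scoped RealInnerProductSpace

noncomputable section

/-- The Haar probability measure on the unit sphere of `EuclideanSpace ℝ (Fin n)`. -/
def sphereProb (n : ℕ) : Measure (Metric.sphere (0 : EuclideanSpace ℝ (Fin n)) 1) :=
  ((volume : Measure (EuclideanSpace ℝ (Fin n))).toSphere Set.univ)⁻¹ •
    (volume : Measure (EuclideanSpace ℝ (Fin n))).toSphere

/-- The convex hull of a compact set in a finite-dimensional real normed space is compact. -/
theorem isCompact_convexHull_of_finiteDimensional {V : Type*} [NormedAddCommGroup V]
    [NormedSpace ℝ V] [FiniteDimensional ℝ V] {s : Set V} (hs : IsCompact s) :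
    IsCompact (convexHull ℝ s) := by
  rcases s.eq_empty_or_nonempty with rfl | ⟨x₀, hx₀⟩
  · simp
  let J := Fin (Module.finrank ℝ V + 1)
  have hc : IsCompact (stdSimplex ℝ J ×ˢ Set.univ.pi fun _ : J => s) :=
    (isCompact_stdSimplex ℝ J).prod (isCompact_univ_pi fun _ => hs)
  have himage := hc.image (f := fun p : (J → ℝ) × (J → V) => ∑ j, p.1 j • p.2 j) (by fun_prop)
  convert himage using 1
  refine Set.Subset.antisymm (fun x hx => ?_) ?_
  · obtain ⟨ι, _, z, w, hz, haff, hw, hw1, rfl⟩ := eq_pos_convex_span_of_mem_convexHull hx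
    obtain ⟨e⟩ : Nonempty (ι ↪ J) := Function.Embedding.nonempty_of_card_le (by
      simpa [J] using haff.card_le_finrank_succ.trans
        (Nat.succ_le_succ (Submodule.finrank_le _)))
    have hzero : ∀ j ∉ Set.range e, Function.extend e w 0 j = 0 := fun j hj => by
      rw [Function.extend_apply' _ _ _ (by simpa using hj)]; rfl
    refine ⟨(Function.extend e w 0, Function.extend e z fun _ => x₀), ⟨⟨fun j => ?_, ?_⟩, ?_⟩, ?_⟩
    · by_cases hj : j ∈ Set.range e
      · obtain ⟨i, rfl⟩ := hj
        simpa [e.injective.extend_apply] using (hw i).le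
      · exact (hzero j hj).ge
    · rw [← hw1]
      exact (Fintype.sum_of_injective e e.injective _ _ hzero
        fun i => (e.injective.extend_apply ..).symm).symm
    · intro j _
      by_cases hj : j ∈ Set.range e
      · obtain ⟨i, rfl⟩ := hj
        simpa [e.injective.extend_apply] using hz ⟨i, rfl⟩
      · simpa [Function.extend_apply' _ _ _ (by simpa using hj)] using hx₀
    · refine (Fintype.sum_of_injective e e.injective _ _ (fun j hj => ?_) fun i => ?_).symm
      · simp [hzero j hj]
      · simp [e.injective.extend_apply]
  · rintro _ ⟨⟨w, z⟩, ⟨⟨hw0, hw1⟩, hz⟩, rfl⟩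
    exact (convex_convexHull ℝ s).sum_mem (fun j _ => hw0 j) hw1
      fun j _ => subset_convexHull ℝ s (hz j trivial)

/-- The integral of a continuous finite-dimensional map against a finite compactly supported
measure is a finite nonnegative combination of its values. -/
theorem exists_finite_quadrature {E V : Type*} [NormedAddCommGroup E] [MeasurableSpace E]
    [BorelSpace E] [SecondCountableTopology E]
    [NormedAddCommGroup V] [NormedSpace ℝ V] [FiniteDimensional ℝ V]
    (μ : Measure E) [IsFiniteMeasure μ] {C : Set E} (hC : IsCompact C) (hμC : μ Cᶜ = 0)
    {F : E → V} (hF : Continuous F) :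
    ∃ (m : ℕ) (c : Fin m → ℝ) (x : Fin m → E), (∀ i, 0 ≤ c i) ∧
      ∀ L : V →L[ℝ] ℝ, ∑ i, c i * L (F (x i)) = ∫ y, L (F y) ∂μ := by
  have hmem : ∀ᵐ y ∂μ, y ∈ C := by
    rw [ae_iff]; exact hμC
  have hint : Integrable F μ := by
    obtain ⟨B, hB⟩ := hC.exists_bound_of_continuousOn hF.continuousOn
    exact Integrable.of_bound hF.aestronglyMeasurable B (hmem.mono hB)
  rcases eq_or_ne μ 0 with rfl | hμ
  · exact ⟨0, Fin.elim0, Fin.elim0, fun i => i.elim0, by simp⟩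
  have : NeZero μ := ⟨hμ⟩
  have hav : ⨍ y, F y ∂μ ∈ convexHull ℝ (F '' C) :=
    (convex_convexHull ℝ _).average_mem
      (isCompact_convexHull_of_finiteDimensional (hC.image hF)).isClosed
      (hmem.mono fun y hy => subset_convexHull ℝ _ (Set.mem_image_of_mem F hy)) hint
  obtain ⟨ι, _, z, w, hz, -, hw, -, hsum⟩ := eq_pos_convex_span_of_mem_convexHull hav
  choose x _ hx using fun i => hz ⟨i, rfl⟩
  let e := (Fintype.equivFin ι).symm
  refine ⟨Fintype.card ι, fun i => μ.real Set.univ * w (e i), fun i => x (e i),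
    fun i => mul_nonneg measureReal_nonneg (hw _).le, fun L => ?_⟩
  rw [L.integral_comp_comm hint, ← measure_smul_average μ F, ← hsum,
    e.sum_comp fun i => μ.real Set.univ * w i * L (F (x i))]
  simp [hx, Finset.mul_sum, mul_assoc]

/-- A Gaussian combination of vectors forming a tight frame is a standard Gaussian vector. -/
theorem map_sum_smul_pi_gaussianReal {E : Type*} [NormedAddCommGroup E] [InnerProductSpace ℝ E]
    [FiniteDimensional ℝ E] [MeasurableSpace E] [BorelSpace E] {m : ℕ} (y : Fin m → E)
    (hy : ∀ θ : E, ∑ i, ⟪y i, θ⟫ ^ 2 = ‖θ‖ ^ 2) :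
    (Measure.pi fun _ : Fin m => gaussianReal 0 1).map (fun g => ∑ i, g i • y i) =
      stdGaussian E := by
  have hmeas : Measurable fun g : Fin m → ℝ => ∑ i, g i • y i := by fun_prop
  have := Measure.isProbabilityMeasure_map (μ := Measure.pi fun _ : Fin m => gaussianReal 0 1)
    hmeas.aemeasurable
  apply Measure.ext_of_charFun
  ext t
  rw [charFun_stdGaussian, charFun_apply, integral_map hmeas.aemeasurable
    (Measurable.aestronglyMeasurable (by fun_prop))]
  simp_rw [sum_inner, Complex.ofReal_sum, Finset.sum_mul, Complex.exp_sum,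
    integral_fintype_prod_eq_prod (f := fun i (x : ℝ) =>
      Complex.exp (((⟪x • y i, t⟫ : ℝ) : ℂ) * Complex.I)),
    real_inner_smul_left, mul_comm _ (⟪_, _⟫), Complex.ofReal_mul, ← charFun_apply_real,
    charFun_gaussianReal]
  simp only [Complex.ofReal_zero, mul_zero, zero_mul, NNReal.coe_one, Complex.ofReal_one, one_mul,
    zero_sub]
  simp_rw [← Complex.exp_sum, Finset.sum_neg_distrib, ← Finset.sum_div, ← Complex.ofReal_pow,
    ← Complex.ofReal_sum, hy, neg_div]

/-- The standard Gaussian measure has density proportional to `exp (-‖x‖² / 2)`. -/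
theorem stdGaussian_eq_withDensity {E : Type*} [NormedAddCommGroup E] [InnerProductSpace ℝ E]
    [FiniteDimensional ℝ E] [MeasurableSpace E] [BorelSpace E] :
    stdGaussian E = (volume : Measure E).withDensity fun x => ENNReal.ofReal
      (((2 * Real.pi) ^ (Module.finrank ℝ E / 2 : ℝ))⁻¹ * Real.exp (-‖x‖ ^ 2 / 2)) := by
  set D : ℝ := (2 * Real.pi) ^ (Module.finrank ℝ E / 2 : ℝ) with hD
  have hDpos : 0 < D := by positivity
  have hint : Integrable fun x : E => D⁻¹ * Real.exp (-‖x‖ ^ 2 / 2) := by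
    refine Integrable.const_mul ?_ _
    have h := (GaussianFourier.integrable_cexp_neg_mul_sq_norm_add (V := E) (b := 1 / 2)
      (by norm_num) 0 0).norm
    refine h.congr (.of_forall fun x => ?_)
    simp only [Complex.norm_exp]
    congr 1
    simp [← Complex.ofReal_pow]
    ring
  have := isFiniteMeasure_withDensity_ofReal hint.2
  apply Measure.ext_of_charFun
  ext t
  rw [charFun_stdGaussian, charFun_apply,
    integral_withDensity_eq_integral_toReal_smul (by fun_prop) (.of_forall fun _ => by simp)]
  have key := GaussianFourier.integral_cexp_neg_mul_sq_norm_add (V := E) (b := 1 / 2)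
      (by norm_num) Complex.I t
  have hDc : ((Real.pi : ℂ) / (1 / 2)) ^ (Module.finrank ℝ E / 2 : ℂ) = (D : ℂ) := by
    rw [hD, Complex.ofReal_cpow (by positivity)]
    push_cast
    congr 1
    ring
  rw [hDc] at key
  have hpt : ∀ x : E, (ENNReal.ofReal (D⁻¹ * Real.exp (-‖x‖ ^ 2 / 2))).toReal •
      Complex.exp (((⟪x, t⟫ : ℝ) : ℂ) * Complex.I) =
      (D : ℂ)⁻¹ * Complex.exp (-(1 / 2) * (‖x‖ : ℂ) ^ 2 + Complex.I * ((⟪t, x⟫ : ℝ) : ℂ)) := by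
    intro x
    rw [ENNReal.toReal_ofReal (by positivity), Complex.real_smul, Complex.exp_add,
      real_inner_comm]
    push_cast
    rw [mul_assoc, mul_comm (Complex.I)]
    congr 4
    ring
  simp_rw [hpt]
  rw [integral_const_mul, key, inv_mul_cancel_left₀ (by exact_mod_cast hDpos.ne')]
  congr 1
  rw [Complex.I_sq]
  ring

/-- Polar integration of a positively `2`-homogeneous function against a Gaussian weight. -/
theorem integral_exp_mul_eq_toSphere {E : Type*} [NormedAddCommGroup E] [NormedSpace ℝ E]
    [FiniteDimensional ℝ E] [Nontrivial E] [MeasurableSpace E] [BorelSpace E]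
    (ν : Measure E) [ν.IsAddHaarMeasure]
    {q : E → ℝ} (hq : ∀ (r : ℝ) (x : E), 0 < r → q (r • x) = r ^ 2 * q x) :
    ∫ x, Real.exp (-‖x‖ ^ 2 / 2) * q x ∂ν =
      (∫ θ : Metric.sphere (0 : E) 1, q θ ∂ν.toSphere) *
        ∫ r : Set.Ioi (0 : ℝ), Real.exp (-(r : ℝ) ^ 2 / 2) * (r : ℝ) ^ 2
          ∂Measure.volumeIoiPow (Module.finrank ℝ E - 1) := by
  have h := ν.measurePreserving_homeomorphUnitSphereProd.integral_comp
    (Homeomorph.measurableEmbedding _)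
    fun p : Metric.sphere (0 : E) 1 × Set.Ioi (0 : ℝ) =>
      q p.1 * (Real.exp (-(p.2 : ℝ) ^ 2 / 2) * (p.2 : ℝ) ^ 2)
  rw [integral_prod_mul (fun θ : Metric.sphere (0 : E) 1 => q θ)
    fun r : Set.Ioi (0 : ℝ) => Real.exp (-(r : ℝ) ^ 2 / 2) * (r : ℝ) ^ 2] at h
  have h₀ := integral_subtype_comap (μ := ν) (measurableSet_singleton (0 : E)).compl
    fun x => Real.exp (-‖x‖ ^ 2 / 2) * q x
  rw [restrict_compl_singleton] at h₀
  rw [← h, ← h₀]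
  refine integral_congr_ae (.of_forall fun x => ?_)
  have hx : 0 < ‖(x : E)‖ := norm_pos_iff.2 x.2
  simp only [homeomorphUnitSphereProd_apply_fst_coe, homeomorphUnitSphereProd_apply_snd_coe]
  rw [hq _ _ (inv_pos.2 hx)]
  field_simp

theorem integral_norm_sq_stdGaussian (n : ℕ) :
    ∫ x, ‖x‖ ^ 2 ∂stdGaussian (EuclideanSpace ℝ (Fin n)) = n := by
  rw [← map_pi_eq_stdGaussian, integral_map (by fun_prop)
    (Continuous.aestronglyMeasurable (by fun_prop))]
  have hsq : Integrable (fun t : ℝ => t ^ 2) (gaussianReal 0 1) :=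
    IsGaussian.memLp_two_id.integrable_sq
  have hone : ∫ t : ℝ, t ^ 2 ∂gaussianReal 0 1 = 1 := by
    have h := variance_fun_id_gaussianReal (μ := 0) (v := 1)
    rw [variance_of_integral_eq_zero (by fun_prop) (by simp)] at h
    simpa using h
  simp_rw [EuclideanSpace.real_norm_sq_eq]
  rw [integral_finsetSum]
  · have (i : Fin n) : ∫ x : Fin n → ℝ, x i ^ 2 ∂Measure.pi (fun _ => gaussianReal 0 1) = 1 := by
      rw [integral_comp_eval (μ := fun _ : Fin n => gaussianReal 0 1) (f := fun t : ℝ => t ^ 2)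
        hsq.aestronglyMeasurable, hone]
    simp [this]
  · exact fun i _ => integrable_comp_eval (μ := fun _ : Fin n => gaussianReal 0 1)
      (f := fun t : ℝ => t ^ 2) hsq

/-- The Gaussian second moment of a positively homogeneous function is `n` times its spherical
second moment. -/
theorem integral_stdGaussian_eq_dim_mul_integral_sphereProb {n : ℕ} (hn : n ≠ 0)
    {q : EuclideanSpace ℝ (Fin n) → ℝ}
    (hq : ∀ (r : ℝ) (x : EuclideanSpace ℝ (Fin n)), 0 < r → q (r • x) = r ^ 2 * q x) :
    ∫ x, q x ∂stdGaussian (EuclideanSpace ℝ (Fin n)) =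
      n * ∫ θ : Metric.sphere (0 : EuclideanSpace ℝ (Fin n)) 1, q θ ∂sphereProb n := by
  have : Nontrivial (EuclideanSpace ℝ (Fin n)) :=
    Module.nontrivial_of_finrank_pos (R := ℝ) (by simpa using Nat.pos_of_ne_zero hn)
  obtain ⟨A, hA⟩ : ∃ A : ℝ, ∀ f : EuclideanSpace ℝ (Fin n) → ℝ,
      (∀ (r : ℝ) (x : EuclideanSpace ℝ (Fin n)), 0 < r → f (r • x) = r ^ 2 * f x) →
      ∫ x, f x ∂stdGaussian (EuclideanSpace ℝ (Fin n)) =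
        A * ∫ θ : Metric.sphere (0 : EuclideanSpace ℝ (Fin n)) 1, f θ
          ∂(volume : Measure (EuclideanSpace ℝ (Fin n))).toSphere := by
    refine ⟨((2 * Real.pi) ^ (Module.finrank ℝ (EuclideanSpace ℝ (Fin n)) / 2 : ℝ))⁻¹ *
      ∫ r : Set.Ioi (0 : ℝ), Real.exp (-(r : ℝ) ^ 2 / 2) * (r : ℝ) ^ 2
        ∂Measure.volumeIoiPow (Module.finrank ℝ (EuclideanSpace ℝ (Fin n)) - 1),
      fun f hf => ?_⟩
    rw [stdGaussian_eq_withDensity,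
      integral_withDensity_eq_integral_toReal_smul (by fun_prop) (.of_forall fun _ => by simp)]
    simp_rw [ENNReal.toReal_ofReal (show 0 ≤ ((2 * Real.pi) ^
      (Module.finrank ℝ (EuclideanSpace ℝ (Fin n)) / 2 : ℝ))⁻¹ * Real.exp _ by positivity),
      smul_eq_mul, mul_assoc]
    rw [integral_const_mul, integral_exp_mul_eq_toSphere volume hf,
      mul_comm (∫ θ : Metric.sphere _ _, _ ∂_), ← mul_assoc]
  have hvol := hA (fun x => ‖x‖ ^ 2) fun r x _ => by
    rw [norm_smul, mul_pow, Real.norm_eq_abs, sq_abs]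
  rw [integral_norm_sq_stdGaussian] at hvol
  simp only [norm_eq_of_mem_sphere, one_pow, integral_const, smul_eq_mul, mul_one] at hvol
  rw [hA q hq, hvol, sphereProb, integral_smul_measure, ENNReal.toReal_inv, smul_eq_mul,
    ← measureReal_def, mul_assoc, mul_inv_cancel_left₀]
  intro h
  rw [h, mul_zero] at hvol
  exact hn (by exact_mod_cast hvol)

/-- Type-2 half of the isotropic measure proposition: if `X_K = (ℝⁿ, ‖·‖_K)` satisfies the
Gaussian type-2 inequality with constant `T₂` and `μ` is a finite, compactly supported
isotropic measure, then `√n · M₂(K) ≤ T₂ (∫ ‖x‖_K² dμ)^{1/2}`. -/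
theorem sqrt_dim_mul_M2_le_type2 {n : ℕ}
    (K : Set (EuclideanSpace ℝ (Fin n))) (hKconv : Convex ℝ K) (hKcompact : IsCompact K)
    (hKsymm : K = -K) (hK0 : (0 : EuclideanSpace ℝ (Fin n)) ∈ interior K)
    (T₂ : ℝ) (hT₂ : 0 ≤ T₂)
    (htype : ∀ (m : ℕ) (x : Fin m → EuclideanSpace ℝ (Fin n)),
      ∫ g : Fin m → ℝ, gauge K (∑ i, g i • x i) ^ 2
          ∂(Measure.pi fun _ : Fin m => gaussianReal 0 1) ≤
        T₂ ^ 2 * ∑ i, gauge K (x i) ^ 2)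
    (μ : Measure (EuclideanSpace ℝ (Fin n))) [IsFiniteMeasure μ]
    (hsupp : ∃ C : Set (EuclideanSpace ℝ (Fin n)), IsCompact C ∧ μ Cᶜ = 0)
    (hiso : ∀ θ : EuclideanSpace ℝ (Fin n), ∫ x, ⟪x, θ⟫ ^ 2 ∂μ = ‖θ‖ ^ 2) :
    Real.sqrt n * Real.sqrt (∫ θ : Metric.sphere (0 : EuclideanSpace ℝ (Fin n)) 1,
        gauge K (θ : EuclideanSpace ℝ (Fin n)) ^ 2 ∂(sphereProb n)) ≤
      T₂ * Real.sqrt (∫ x, gauge K x ^ 2 ∂μ) := by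
  rcases eq_or_ne n 0 with rfl | hn
  · simpa using mul_nonneg hT₂ (Real.sqrt_nonneg _)
  obtain ⟨C, hC, hμC⟩ := hsupp
  have hcont : Continuous (gauge K) := continuous_gauge hKconv (mem_interior_iff_mem_nhds.1 hK0)
  have hF : Continuous fun x : EuclideanSpace ℝ (Fin n) =>
      (ContinuousLinearMap.smulRight (innerSL ℝ x) x, gauge K x ^ 2) := by
    fun_prop
  obtain ⟨m, c, x, hc, hquad⟩ := exists_finite_quadrature μ hC hμC hF
  let y : Fin m → EuclideanSpace ℝ (Fin n) := fun i => Real.sqrt (c i) • x i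
  have hframe (θ : EuclideanSpace ℝ (Fin n)) : ∑ i, ⟪y i, θ⟫ ^ 2 = ‖θ‖ ^ 2 := by
    have h := hquad (((innerSL ℝ θ).comp (ContinuousLinearMap.apply ℝ _ θ)).comp
      (ContinuousLinearMap.fst ℝ _ _))
    simp only [ContinuousLinearMap.comp_apply, ContinuousLinearMap.coe_fst',
      ContinuousLinearMap.apply_apply, ContinuousLinearMap.smulRight_apply, innerSL_apply_apply,
      real_inner_comm _ θ, real_inner_smul_left, ← sq] at h
    rw [← hiso θ, ← h]
    simp [y, real_inner_smul_left, mul_pow, Real.sq_sqrt (hc _)]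
  have hgauge : ∑ i, gauge K (y i) ^ 2 = ∫ z, gauge K z ^ 2 ∂μ := by
    have h := hquad (ContinuousLinearMap.snd ℝ _ _)
    simp only [ContinuousLinearMap.coe_snd'] at h
    rw [← h]
    refine Finset.sum_congr rfl fun i _ => ?_
    rw [gauge_smul_of_nonneg (Real.sqrt_nonneg _), smul_eq_mul, mul_pow, Real.sq_sqrt (hc i)]
  have hmain := htype m y
  rw [hgauge, ← integral_map (φ := fun g : Fin m → ℝ => ∑ i, g i • y i)
    (f := fun z => gauge K z ^ 2) (Measurable.aemeasurable (by fun_prop)) (hcont.pow 2).aestronglyMeasurable,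
    map_sum_smul_pi_gaussianReal y hframe,
    integral_stdGaussian_eq_dim_mul_integral_sphereProb hn fun r z hr => by
      rw [gauge_smul_of_nonneg hr.le, smul_eq_mul, mul_pow]] at hmain
  rw [← Real.sqrt_mul (Nat.cast_nonneg n)]
  calc _ ≤ Real.sqrt (T₂ ^ 2 * ∫ z, gauge K z ^ 2 ∂μ) := Real.sqrt_le_sqrt hmain
    _ = _ := by rw [Real.sqrt_mul (sq_nonneg _), Real.sqrt_sq hT₂]
end
end
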